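/- arXiv:0904.1530 — 2 statements merged into one kernel-verified Lean document; each statement's English description precedes it below -/
import Mathlib

section
/- For every real q with q > 0 and q ≠ 1, and all p, r ∈ 𝒮ⁿ, the Tsallis relative entropy satisfies K_q(p,r) ≥ 0, and K_q(p,r) = 0 if and only if p = r. -/
/-- The Tsallis relative entropy `K_q(p,r) = (1 - ∑ i, p i ^ q * r i ^ (1-q)) / (1 - q)`. -/
noncomputable def TsallisRelEntropy {ι : Type*} [Fintype ι] (q : ℝ) (p r : ι → ℝ) : ℝ :=
  (1 - ∑ i, p i ^ q * r i ^ (1 - q)) / (1 - q)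

/-- The Tsallis divergence of two distinct positive weights, corrected by the linear term
`q * x + (1 - q) * y`, is positive. -/
theorem tsallis_term_pos {q x y : ℝ} (hq0 : 0 < q) (hq1 : q ≠ 1) (hx : 0 < x) (hy : 0 < y)
    (hxy : x ≠ y) : 0 < (q * x + (1 - q) * y - x ^ q * y ^ (1 - q)) / (1 - q) := by
  have hs : -1 ≤ x / y - 1 := by linarith [div_pos hx hy]
  have hs' : x / y - 1 ≠ 0 := sub_ne_zero.mpr fun h => hxy ((div_eq_one_iff_eq hy.ne').mp h)
  have hpow : x ^ q * y ^ (1 - q) = y * (1 + (x / y - 1)) ^ q := by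
    rw [add_sub_cancel, Real.div_rpow hx.le hy.le, Real.rpow_sub hy, Real.rpow_one]
    ring
  have hlin : q * x + (1 - q) * y = y * (1 + q * (x / y - 1)) := by
    field_simp
    ring
  rw [hpow, hlin, ← mul_sub]
  rcases hq1.lt_or_gt with h | h
  · exact div_pos (mul_pos hy (sub_pos.mpr (rpow_one_add_lt_one_add_mul_self hs hs' hq0 h)))
      (sub_pos.mpr h)
  · exact div_pos_of_neg_of_neg
      (mul_neg_of_pos_of_neg hy (sub_neg.mpr (one_add_mul_self_lt_rpow_one_add hs hs' h)))
      (sub_neg.mpr h)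

/-- The corrected Tsallis divergence of a positive weight from itself vanishes. -/
theorem tsallis_term_self {q x : ℝ} (hx : 0 < x) :
    (q * x + (1 - q) * x - x ^ q * x ^ (1 - q)) / (1 - q) = 0 := by
  rw [← Real.rpow_add hx, add_sub_cancel, Real.rpow_one]
  ring

/-- On the probability simplex the linear corrections sum to one. -/
theorem tsallisRelEntropy_eq_sum {ι : Type*} [Fintype ι] (q : ℝ) {p r : ι → ℝ}
    (hp : ∑ i, p i = 1) (hr : ∑ i, r i = 1) :
    TsallisRelEntropy q p r =
      ∑ i, (q * p i + (1 - q) * r i - p i ^ q * r i ^ (1 - q)) / (1 - q) := by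
  rw [TsallisRelEntropy, ← Finset.sum_div, Finset.sum_sub_distrib, Finset.sum_add_distrib,
    ← Finset.mul_sum, ← Finset.mul_sum, hp, hr]
  ring

/-- For `0 < q`, `q ≠ 1`, the Tsallis relative entropy is nonnegative on the probability
simplex, and vanishes iff the two distributions coincide. -/
theorem tsallis_rel_entropy_nonneg_eq_zero_iff (n : ℕ) (q : ℝ) (hq0 : 0 < q) (hq1 : q ≠ 1)
    (p r : Fin (n + 1) → ℝ)
    (hp_pos : ∀ i, 0 < p i) (hp_sum : ∑ i, p i = 1)
    (hr_pos : ∀ i, 0 < r i) (hr_sum : ∑ i, r i = 1) :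
    0 ≤ TsallisRelEntropy q p r ∧ (TsallisRelEntropy q p r = 0 ↔ p = r) := by
  have hnonneg (i) : 0 ≤ (q * p i + (1 - q) * r i - p i ^ q * r i ^ (1 - q)) / (1 - q) := by
    by_cases h : p i = r i
    · rw [h, tsallis_term_self (hr_pos i)]
    · exact (tsallis_term_pos hq0 hq1 (hp_pos i) (hr_pos i) h).le
  rw [tsallisRelEntropy_eq_sum q hp_sum hr_sum]
  refine ⟨Finset.sum_nonneg fun i _ => hnonneg i, ?_⟩
  rw [Finset.sum_eq_zero_iff_of_nonneg fun i _ => hnonneg i]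
  refine ⟨fun h => funext fun i => ?_, ?_⟩
  · by_contra hne
    exact (tsallis_term_pos hq0 hq1 (hp_pos i) (hr_pos i) hne).ne' (h i (Finset.mem_univ i))
  · rintro rfl i -
    exact tsallis_term_self (hp_pos i)
end

section
/- Moment evolution for the nonlinear Fokker–Planck equation: let m > 1, β > 0, let D be a real symmetric positive definite n×n matrix, T > 0, and let p : ℝⁿ × [0,T] → ℝ be nonnegative with p and (x,τ) ↦ p(x,τ)^m of class C², with p(·,τ) supported in a fixed compact set for all τ ∈ [0,T], satisfying ∂p/∂τ = ∇_x · (β x p + D ∇_x(p^m)) pointwise. Then for each i, (d/dτ) ∫ x_i p(x,τ) dx = −β ∫ x_i p(x,τ) dx, and for each i, j, (d/dτ) ∫ x_i x_j p(x,τ) dx = −2β ∫ x_i x_j p(x,τ) dx + 2 D_{ij} ∫ p(x,τ)^m dx. -/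
open MeasureTheory Set Matrix

/-- The partial derivative `∂f/∂x_i` of a function `f : ℝⁿ → ℝ`. -/
noncomputable def pd {n : ℕ} (i : Fin n) (f : (Fin n → ℝ) → ℝ) (x : Fin n → ℝ) : ℝ :=
  fderiv ℝ f x (Pi.single i 1)

section PartialDerivatives

variable {n : ℕ} {f g q u φ : (Fin n → ℝ) → ℝ} {i : Fin n}

lemma ContDiff.pd {k l : WithTop ℕ∞} (hf : ContDiff ℝ l f) (hkl : k + 1 ≤ l) :
    ContDiff ℝ k (pd i f) :=
  (hf.fderiv_right hkl).clm_apply contDiff_const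

lemma HasCompactSupport.pd (hf : HasCompactSupport f) : HasCompactSupport (pd i f) :=
  hf.fderiv_apply ℝ _

lemma pd_coord (k : Fin n) (x : Fin n → ℝ) :
    pd k (fun y => y i) x = if k = i then 1 else 0 := by
  have h : HasFDerivAt (fun y : Fin n → ℝ => y i) (ContinuousLinearMap.proj (R := ℝ) i) x :=
    hasFDerivAt_apply i x
  simp [_root_.pd, h.fderiv, Pi.single_apply, eq_comm]

lemma pd_mul (k : Fin n) (hf : Differentiable ℝ f) (hg : Differentiable ℝ g) (x : Fin n → ℝ) :
    pd k (fun y => f y * g y) x = pd k f x * g x + f x * pd k g x := by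
  simp only [_root_.pd, fderiv_fun_mul (hf x) (hg x)]
  simp
  ring

lemma pd_add (k : Fin n) (hf : Differentiable ℝ f) (hg : Differentiable ℝ g) (x : Fin n → ℝ) :
    pd k (fun y => f y + g y) x = pd k f x + pd k g x := by
  simp [_root_.pd, fderiv_fun_add (hf x) (hg x)]

@[simp]
lemma pd_const (k : Fin n) (c : ℝ) (x : Fin n → ℝ) : pd k (fun _ => c) x = 0 := by
  simp [_root_.pd]

lemma Continuous.integrable_mul_of_hasCompactSupport (hf : Continuous f) (hg : Continuous g)
    (hgs : HasCompactSupport g) : Integrable (fun x => f x * g x) :=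
  (hf.mul hg).integrable_of_hasCompactSupport hgs.mul_left

/-- Integration by parts against a compactly supported function. -/
lemma integral_mul_pd (hf : ContDiff ℝ 1 f) (hg : ContDiff ℝ 1 g) (hgs : HasCompactSupport g) :
    ∫ x, f x * pd i g x = -∫ x, pd i f x * g x := by
  have hf' : Continuous (pd i f) := (hf.pd (k := 0) (by simp)).continuous
  have hg' : Continuous (pd i g) := (hg.pd (k := 0) (by simp)).continuous
  exact integral_mul_fderiv_eq_neg_fderiv_mul_of_integrable
    (hf'.integrable_mul_of_hasCompactSupport hg.continuous hgs)
    (hf.continuous.integrable_mul_of_hasCompactSupport hg' hgs.pd)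
    (hf.continuous.integrable_mul_of_hasCompactSupport hg.continuous hgs)
    (fun x _ => hf.differentiable (by simp) x) (fun x _ => hg.differentiable (by simp) x)

/-- Weak form of the Fokker–Planck operator tested against a `C²` function. -/
lemma integral_mul_sum_pd_flux (β : ℝ) (D : Matrix (Fin n) (Fin n) ℝ)
    (hq : ContDiff ℝ 1 q) (hqs : HasCompactSupport q)
    (hu : ContDiff ℝ 2 u) (hus : HasCompactSupport u) (hφ : ContDiff ℝ 2 φ) :
    ∫ x, φ x * ∑ i, pd i (fun y => β * y i * q y + ∑ j, D i j * pd j u y) x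
      = ∑ i, (-β * ∫ x, pd i φ x * (x i * q x))
        + ∑ i, ∑ j, D i j * ∫ x, pd j (pd i φ) x * u x := by
  have hdrift (i : Fin n) : ContDiff ℝ 1 fun y : Fin n → ℝ => β * y i * q y :=
    (contDiff_const.mul (contDiff_apply ℝ ℝ i)).mul hq
  have hpdu (j : Fin n) : ContDiff ℝ 1 (pd j u) := hu.pd (by norm_num)
  have hpdφ (j : Fin n) : ContDiff ℝ 1 (pd j φ) := hφ.pd (by norm_num)
  have hflux (i : Fin n) :
      ContDiff ℝ 1 fun y : Fin n → ℝ => β * y i * q y + ∑ j, D i j * pd j u y :=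
    (hdrift i).add (ContDiff.sum fun j _ => contDiff_const.mul (hpdu j))
  have hfluxs (i : Fin n) :
      HasCompactSupport fun y : Fin n → ℝ => β * y i * q y + ∑ j, D i j * pd j u y := by
    refine HasCompactSupport.intro (hqs.isCompact.union hus.isCompact) fun y hy => ?_
    rw [mem_union, not_or] at hy
    have hy' (j : Fin n) : pd j u y = 0 := by
      simp [_root_.pd, fderiv_of_notMem_tsupport ℝ hy.2]
    simp [hy', image_eq_zero_of_notMem_tsupport hy.1]
  have hφ1 : ContDiff ℝ 1 φ := hφ.of_le (by norm_num)
  simp only [Finset.mul_sum]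
  rw [integral_finsetSum _ fun i _ => hφ.continuous.integrable_mul_of_hasCompactSupport
    ((hflux i).pd (k := 0) (by simp)).continuous (hfluxs i).pd, ← Finset.sum_add_distrib]
  refine Finset.sum_congr rfl fun i _ => ?_
  rw [integral_mul_pd hφ1 (hflux i) (hfluxs i)]
  have h_int (j : Fin n) : Integrable fun x => pd i φ x * (D i j * pd j u x) :=
    (hpdφ i).continuous.integrable_mul_of_hasCompactSupport
      (continuous_const.mul (hpdu j).continuous) hus.pd.mul_left
  have hdrift_int : Integrable fun x => pd i φ x * (β * x i * q x) :=
    (hpdφ i).continuous.integrable_mul_of_hasCompactSupport (hdrift i).continuous hqs.mul_left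
  simp only [mul_add, Finset.mul_sum]
  rw [integral_add hdrift_int (integrable_finsetSum _ fun j _ => h_int j),
    integral_finsetSum _ fun j _ => h_int j, neg_add, ← Finset.sum_neg_distrib]
  congr 1
  · rw [neg_mul, ← integral_const_mul]
    congr 2
    ext x
    ring
  · refine Finset.sum_congr rfl fun j _ => ?_
    rw [← neg_eq_iff_eq_neg.mpr (integral_mul_pd (hpdφ i) (hu.of_le (by norm_num)) hus),
      mul_neg, ← integral_const_mul]
    congr 2
    ext x
    ring

end PartialDerivatives

/-- Differentiation of an integral over a compact set with a jointly `C¹` integrand. -/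
lemma IsCompact.hasDerivAt_setIntegral {n : ℕ} {K : Set (Fin n → ℝ)} (hK : IsCompact K)
    {F : (Fin n → ℝ) → ℝ → ℝ} (hF : ContDiff ℝ 1 fun w : (Fin n → ℝ) × ℝ => F w.1 w.2) (τ : ℝ) :
    HasDerivAt (fun s => ∫ x in K, F x s) (∫ x in K, deriv (F x) τ) τ := by
  have hd (x : Fin n → ℝ) (s : ℝ) : HasDerivAt (F x)
      (fderiv ℝ (fun w : (Fin n → ℝ) × ℝ => F w.1 w.2) (x, s) (0, 1)) s :=
    (hF.differentiable (by simp) (x, s)).hasFDerivAt.comp_hasDerivAt (f := fun s => (x, s)) s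
      ((hasDerivAt_const s x).prodMk (hasDerivAt_id s))
  have hc : Continuous fun w : (Fin n → ℝ) × ℝ => deriv (F w.1) w.2 := by
    simp only [(hd _ _).deriv]
    exact (hF.continuous_fderiv (by simp)).clm_apply continuous_const
  obtain ⟨C, hC⟩ := (hK.prod (isCompact_Icc (a := τ - 1) (b := τ + 1))).exists_bound_of_continuousOn
    hc.continuousOn
  have : IsFiniteMeasure (volume.restrict K) := ⟨by simpa using hK.measure_lt_top⟩
  refine (hasDerivAt_integral_of_dominated_loc_of_deriv_le (bound := fun _ => C)
    (F' := fun s x => deriv (F x) s) (Icc_mem_nhds (sub_one_lt τ) (lt_add_one τ))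
    (Filter.Eventually.of_forall fun s => ?_) ?_ ?_ ?_ (integrable_const C) ?_).2
  · exact (hF.continuous.comp (Continuous.prodMk_left s)).aestronglyMeasurable
  · exact (hF.continuous.comp (Continuous.prodMk_left τ)).continuousOn.integrableOn_compact hK
  · exact (hc.comp (Continuous.prodMk_left τ)).aestronglyMeasurable
  · exact (ae_restrict_iff' hK.measurableSet).2
      (Filter.Eventually.of_forall fun x hx s hs => hC (x, s) ⟨hx, hs⟩)
  · exact Filter.Eventually.of_forall fun x s _ => (hd x s).differentiableAt.hasDerivAt

/-- Evolution of `∫ φ p` for a `C¹` weight `φ`, when `p` is supported in `K` on `[0, T]`. -/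
lemma hasDerivWithinAt_integral_mul {n : ℕ} {K : Set (Fin n → ℝ)} (hK : IsCompact K) {T : ℝ}
    (hT : 0 < T) {p : (Fin n → ℝ) → ℝ → ℝ} {φ : (Fin n → ℝ) → ℝ}
    (hp : ContDiff ℝ 1 fun w : (Fin n → ℝ) × ℝ => p w.1 w.2) (hφ : ContDiff ℝ 1 φ)
    (hsupp : ∀ τ ∈ Icc (0 : ℝ) T, ∀ x ∉ K, p x τ = 0) {τ : ℝ} (hτ : τ ∈ Icc (0 : ℝ) T) :
    HasDerivWithinAt (fun s => ∫ x, φ x * p x s) (∫ x, φ x * deriv (p x) τ) (Icc 0 T) τ := by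
  have hdiff (x : Fin n → ℝ) : Differentiable ℝ (p x) :=
    (hp.comp (contDiff_prodMk_right x)).differentiable (by simp)
  have hderiv (x : Fin n → ℝ) (hx : x ∉ K) : deriv (p x) τ = 0 := by
    rw [← (hdiff x τ).derivWithin (uniqueDiffOn_Icc hT τ hτ),
      derivWithin_congr (f := fun _ => (0 : ℝ)) (fun s hs => hsupp s hs x hx) (hsupp τ hτ x hx)]
    simp
  have key := hK.hasDerivAt_setIntegral (F := fun x s => φ x * p x s)
    ((hφ.comp contDiff_fst).mul hp) τ
  simp only [deriv_const_mul_field'] at key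
  rw [setIntegral_eq_integral_of_forall_compl_eq_zero fun x hx => by simp [hderiv x hx]] at key
  refine key.hasDerivWithinAt.congr_of_mem (fun s hs => ?_) hτ
  exact (setIntegral_eq_integral_of_forall_compl_eq_zero fun x hx => by
    simp [hsupp s hs x hx]).symm

/-- Moment evolution for the nonlinear Fokker–Planck equation
`∂p/∂τ = ∇·(β x p + D ∇(p^m))`: for a nonnegative compactly supported `C²` solution,
`(d/dτ) ∫ x_i p dx = -β ∫ x_i p dx` and
`(d/dτ) ∫ x_i x_j p dx = -2β ∫ x_i x_j p dx + 2 D_{ij} ∫ p^m dx`. -/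
theorem nfpe_moment_evolution (n : ℕ) (m : ℝ) (hm : 1 < m) (β : ℝ) (hβ : 0 < β)
    (D : Matrix (Fin n) (Fin n) ℝ) (hD : D.PosDef)
    (T : ℝ) (hT : 0 < T)
    (K : Set (Fin n → ℝ)) (hK : IsCompact K)
    (p : (Fin n → ℝ) → ℝ → ℝ)
    (hp_nonneg : ∀ x τ, 0 ≤ p x τ)
    (hp_smooth : ContDiff ℝ 2 (fun w : (Fin n → ℝ) × ℝ => p w.1 w.2))
    (hpm_smooth : ContDiff ℝ 2 (fun w : (Fin n → ℝ) × ℝ => p w.1 w.2 ^ m))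
    (hsupp : ∀ τ ∈ Icc (0:ℝ) T, ∀ x ∉ K, p x τ = 0)
    (hNFPE : ∀ x, ∀ τ ∈ Icc (0:ℝ) T,
      deriv (fun s => p x s) τ
        = ∑ i, pd i
            (fun y => β * y i * p y τ + ∑ j, D i j * pd j (fun y' => p y' τ ^ m) y) x) :
    (∀ i, ∀ τ ∈ Icc (0:ℝ) T,
      HasDerivWithinAt (fun s => ∫ x, x i * p x s)
        (-β * ∫ x, x i * p x τ) (Icc 0 T) τ)
    ∧ (∀ i j, ∀ τ ∈ Icc (0:ℝ) T,
      HasDerivWithinAt (fun s => ∫ x, x i * x j * p x s)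
        (-(2 * β) * (∫ x, x i * x j * p x τ) + 2 * D i j * ∫ x, p x τ ^ m)
        (Icc 0 T) τ) := by
  have hweak (φ : (Fin n → ℝ) → ℝ) (hφ : ContDiff ℝ 2 φ) (τ : ℝ) (hτ : τ ∈ Icc (0 : ℝ) T) :
      HasDerivWithinAt (fun s => ∫ x, φ x * p x s)
        (∑ k, (-β * ∫ x, pd k φ x * (x k * p x τ))
          + ∑ k, ∑ l, D k l * ∫ x, pd l (pd k φ) x * p x τ ^ m) (Icc 0 T) τ := by
    rw [← integral_mul_sum_pd_flux β D (q := fun x => p x τ) (u := fun x => p x τ ^ m)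
      ((hp_smooth.comp (contDiff_prodMk_left τ)).of_le (by norm_num))
      (HasCompactSupport.intro hK (hsupp τ hτ)) (hpm_smooth.comp (contDiff_prodMk_left τ))
      (HasCompactSupport.intro hK fun x hx => by
        simp [hsupp τ hτ x hx, Real.zero_rpow (by linarith : m ≠ 0)]) hφ]
    simp only [← hNFPE _ τ hτ]
    exact hasDerivWithinAt_integral_mul hK hT (hp_smooth.of_le (by norm_num))
      (hφ.of_le (by norm_num)) hsupp hτ
  have hcoord (i : Fin n) : ContDiff ℝ 2 fun x : Fin n → ℝ => x i := contDiff_apply ℝ ℝ i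
  have hcoord' (i : Fin n) : Differentiable ℝ fun x : Fin n → ℝ => x i :=
    (hcoord i).differentiable (by simp)
  refine ⟨fun i τ hτ => ?_, fun i j τ hτ => ?_⟩
  · convert hweak _ (hcoord i) τ hτ using 1
    have h1 (k : Fin n) : pd k (fun y : Fin n → ℝ => y i) = fun _ => if k = i then 1 else 0 :=
      funext (pd_coord k)
    have h2 (k : Fin n) : ∫ x, (if k = i then 1 else 0) * (x k * p x τ)
        = if k = i then ∫ x, x i * p x τ else 0 := by
      split_ifs with h <;> simp [h]
    simp only [h1, h2, ← Finset.mul_sum]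
    simp
  · convert hweak _ ((hcoord i).mul (hcoord j)) τ hτ using 1
    have h1 (k : Fin n) : pd k (fun y : Fin n → ℝ => y i * y j)
        = fun x => (if k = i then 1 else 0) * x j + x i * (if k = j then 1 else 0) := by
      ext x
      rw [pd_mul k (hcoord' i) (hcoord' j), pd_coord, pd_coord]
    have h2 (k l : Fin n) : pd l (pd k (fun y : Fin n → ℝ => y i * y j))
        = fun _ => (if k = i then 1 else 0) * (if l = j then 1 else 0)
          + (if l = i then 1 else 0) * (if k = j then 1 else 0) := by
      ext x
      rw [h1, pd_add l ((hcoord' j).const_mul _) ((hcoord' i).mul_const _),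
        pd_mul l (differentiable_const _) (hcoord' j), pd_mul l (hcoord' i) (differentiable_const _)]
      simp [pd_coord]
    have h3 : ∑ k, (-β * ∫ x, pd k (fun y : Fin n → ℝ => y i * y j) x * (x k * p x τ))
        = -(2 * β) * ∫ x, x i * x j * p x τ := by
      have h_int (k : Fin n) : Integrable fun x : Fin n → ℝ =>
          pd k (fun y : Fin n → ℝ => y i * y j) x * (x k * p x τ) := by
        refine Continuous.integrable_mul_of_hasCompactSupport ?_ ?_ ?_
        · exact (((hcoord i).mul (hcoord j)).pd (k := 1) (by norm_num)).continuous
        · exact (continuous_apply k).mul (hp_smooth.continuous.comp (Continuous.prodMk_left τ))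
        · exact HasCompactSupport.intro hK fun x hx => by simp [hsupp τ hτ x hx]
      rw [← Finset.mul_sum, ← integral_finsetSum _ fun k _ => h_int k, neg_mul, neg_mul,
        mul_comm 2 β, mul_assoc, ← integral_const_mul 2]
      congr 3
      ext x
      simp only [h1, add_mul, Finset.sum_add_distrib, ite_mul, mul_ite, one_mul, mul_one,
        zero_mul, mul_zero, Finset.sum_ite_eq', Finset.mem_univ, if_true]
      ring
    have hDsymm : D j i = D i j := by simpa using hD.isHermitian.apply i j
    rw [h3]
    simp only [h2, integral_const_mul]
    congr 1
    simp [mul_add, add_mul, Finset.sum_add_distrib, hDsymm]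
    ring
end
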